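/- arXiv:1710.07854 — 3 statements merged into one kernel-verified Lean document; each statement's English description precedes it below -/
import Mathlib

section
/- The λ-open topology τ_λ makes (C(X,ℝ^ι),+) a paratopological group (i.e., the map (f,g) ↦ f+g is jointly continuous from τ_λ × τ_λ to τ_λ) if and only if every member of λ is C_ι-compact in X and λ = λ(C_ι). -/
open Topology Set

/-- The λ-open (set-open) topology on `C(X, ι → ℝ)` generated by the subbasis
`[A, U] = {f | f(A) ⊆ U}` for `A ∈ Λ` and `U` open in `ι → ℝ`. -/
def setOpenTopology {X : Type*} [TopologicalSpace X] (ι : Type*) (Λ : Set (Set X)) :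
    TopologicalSpace C(X, ι → ℝ) :=
  TopologicalSpace.generateFrom
    {S | ∃ A ∈ Λ, ∃ U : Set (ι → ℝ), IsOpen U ∧ S = {f : C(X, ι → ℝ) | Set.MapsTo f A U}}

/-- A subset `B ⊆ X` is `C_ι`-compact in `X` if `f(B)` is compact in `ℝ^ι`
for every continuous `f : X → ℝ^ι`. -/
def CCompactIn {X : Type*} [TopologicalSpace X] (ι : Type*) (B : Set X) : Prop :=
  ∀ f : C(X, ι → ℝ), IsCompact (⇑f '' B)

/-- The family `λ(C_ι)`. -/
def lambdaC {X : Type*} [TopologicalSpace X] (ι : Type*) (Λ : Set (Set X)) : Set (Set X) :=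
  {A | A ∈ Λ ∧ ∀ B ⊆ A, CCompactIn ι B → ∀ U : Set (ι → ℝ), IsOpen U →
    IsOpen[setOpenTopology ι Λ] {f : C(X, ι → ℝ) | Set.MapsTo f B U}}

theorem continuous_const_setOpenTopology {X : Type*} [TopologicalSpace X] {ι : Type*}
    {Λ : Set (Set X)} (hΛ : ∀ A ∈ Λ, A.Nonempty) :
    Continuous[_, setOpenTopology ι Λ] (fun c : ι → ℝ => ContinuousMap.const X c) := by
  refine continuous_generateFrom_iff.2 ?_
  rintro _ ⟨A, hA, U, hU, rfl⟩
  obtain ⟨a, ha⟩ := hΛ A hA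
  convert hU using 1
  ext c
  exact ⟨fun h => h ha, fun h _ _ => h⟩

theorem isOpen_mapsTo_setOpenTopology {X : Type*} [TopologicalSpace X] {ι : Type*}
    {Λ : Set (Set X)} {A : Set X} (hA : A ∈ Λ) {U : Set (ι → ℝ)} (hU : IsOpen U) :
    IsOpen[setOpenTopology ι Λ] {f : C(X, ι → ℝ) | MapsTo f A U} :=
  TopologicalSpace.isOpen_generateFrom_of_mem ⟨A, hA, U, hU, rfl⟩

/-- If all images of `A` under continuous maps to `ℝ^ι` are closed, then they are all compact. -/
theorem cCompactIn_of_forall_isClosed {X : Type*} [TopologicalSpace X] {ι : Type*} {A : Set X}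
    (h : ∀ f : C(X, ι → ℝ), IsClosed (f '' A)) : CCompactIn ι A := by
  intro f
  let g : C(X, ι → ℝ) := ⟨fun x i => Real.arctan (f x i), by fun_prop⟩
  have hg : IsCompact (g '' A) := by
    refine (isCompact_univ_pi fun _ : ι =>
      isCompact_Icc (a := -(Real.pi / 2)) (b := Real.pi / 2)).of_isClosed_subset (h g) ?_
    rintro _ ⟨x, -, rfl⟩ i -
    exact ⟨(Real.neg_pi_div_two_lt_arctan _).le, (Real.arctan_lt_pi_div_two _).le⟩
  have htan : ContinuousOn (fun (y : ι → ℝ) i => Real.tan (y i)) (g '' A) := by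
    refine continuousOn_pi.2 fun i => Real.continuousOn_tan_Ioo.comp
      (continuous_apply i).continuousOn ?_
    rintro _ ⟨x, -, rfl⟩
    exact ⟨Real.neg_pi_div_two_lt_arctan _, Real.arctan_lt_pi_div_two _⟩
  convert hg.image_of_continuousOn htan using 1
  rw [image_image]
  refine image_congr fun x _ => ?_
  ext i
  exact (Real.tan_arctan _).symm

theorem CCompactIn.isCompact_image_real {X : Type*} [TopologicalSpace X] {ι : Type*} [Nonempty ι]
    {A : Set X} (hA : CCompactIn ι A) (φ : C(X, ℝ)) : IsCompact (φ '' A) := by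
  obtain ⟨i⟩ := ‹Nonempty ι›
  have := (hA ⟨fun x _ => φ x, by fun_prop⟩).image (continuous_apply i)
  rwa [image_image] at this

theorem CCompactIn.isCompact_image_of_properSpace {X : Type*} [TopologicalSpace X] {ι : Type*}
    [Nonempty ι] {A : Set X} (hA : CCompactIn ι A) {Y : Type*} [MetricSpace Y] [ProperSpace Y]
    (h : C(X, Y)) : IsCompact (h '' A) := by
  have key (p : Y) : IsCompact ((fun y => dist y p) '' (h '' A)) := by
    rw [image_image]
    exact hA.isCompact_image_real ⟨fun x => dist (h x) p, by fun_prop⟩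
  refine Metric.isCompact_of_isClosed_isBounded (isClosed_of_closure_subset fun p hp => ?_) ?_
  · have h0 := image_closure_subset_closure_image
      (show Continuous fun y => dist y p by fun_prop) (mem_image_of_mem _ hp)
    rw [(key p).isClosed.closure_eq] at h0
    obtain ⟨y, hy, hyp⟩ := h0
    rw [dist_self, dist_eq_zero] at hyp
    exact hyp ▸ hy
  · rcases A.eq_empty_or_nonempty with rfl | ⟨a, -⟩
    · simp
    · obtain ⟨r, hr⟩ := (key (h a)).bddAbove
      exact (Metric.isBounded_iff_subset_closedBall (h a)).2
        ⟨r, fun y hy => hr (mem_image_of_mem _ hy)⟩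

theorem CCompactIn.sum {X : Type*} [TopologicalSpace X] {ι : Type*} [Nonempty ι]
    {A : Set X} (hA : CCompactIn ι A) : CCompactIn (ι ⊕ ι) A := by
  intro h
  cases finite_or_infinite ι with
  | inl _ =>
    have := Fintype.ofFinite ι
    exact hA.isCompact_image_of_properSpace h
  | inr _ =>
    obtain ⟨e⟩ : Nonempty (ι ⊕ ι ≃ ι) := by
      rw [← Cardinal.eq, Cardinal.mk_sum, Cardinal.lift_id,
        Cardinal.add_eq_self (Cardinal.aleph0_le_mk ι)]
    have := (hA ⟨fun x i => h x (e.symm i), by fun_prop⟩).image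
      (show Continuous fun (y : ι → ℝ) k => y (e k) by fun_prop)
    simpa [image_image] using this

theorem CCompactIn.isCompact_image_prod {X : Type*} [TopologicalSpace X] {ι : Type*} [Nonempty ι]
    {A : Set X} (hA : CCompactIn ι A) (f g : C(X, ι → ℝ)) :
    IsCompact ((fun x => (f x, g x)) '' A) := by
  have := (hA.sum ⟨fun x => Sum.elim (f x) (g x), continuous_pi (by rintro (i | i) <;>
      simp only [Sum.elim_inl, Sum.elim_inr] <;> fun_prop)⟩).image
    (show Continuous fun y : ι ⊕ ι → ℝ => ((fun i => y (.inl i)), fun i => y (.inr i)) by fun_prop)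
  simpa [image_image] using this

/-- Intersecting a `C_ι`-compact set with the preimage of a closed subset of `ℝ^ι × ℝ^ι`
gives a `C_ι`-compact set. -/
theorem CCompactIn.inter_preimage_prod {X : Type*} [TopologicalSpace X] {ι : Type*} [Nonempty ι]
    {A : Set X} (hA : CCompactIn ι A) (f g : C(X, ι → ℝ)) {N : Set ((ι → ℝ) × (ι → ℝ))}
    (hN : IsClosed N) : CCompactIn ι (A ∩ (fun x => (f x, g x)) ⁻¹' N) := by
  intro k
  let u : C(X, ι ⊕ ι → ℝ) := ⟨fun x => Sum.elim (k x) (k x), continuous_pi (by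
    rintro (i | i) <;> simp only [Sum.elim_inl, Sum.elim_inr] <;> fun_prop)⟩
  let v : C(X, ι ⊕ ι → ℝ) := ⟨fun x => Sum.elim (f x) (g x), continuous_pi (by
    rintro (i | i) <;> simp only [Sum.elim_inl, Sum.elim_inr] <;> fun_prop)⟩
  let pr : (ι ⊕ ι → ℝ) × (ι ⊕ ι → ℝ) → (ι → ℝ) × (ι → ℝ) :=
    fun q => ((fun i => q.2 (.inl i)), fun i => q.2 (.inr i))
  have hpr : Continuous pr := by fun_prop
  have := ((hA.sum.isCompact_image_prod u v).inter_right (hN.preimage hpr)).image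
    (show Continuous fun q : (ι ⊕ ι → ℝ) × (ι ⊕ ι → ℝ) => fun i => q.1 (.inl i) by fun_prop)
  rwa [← image_inter_preimage, image_image] at this

section Add

variable {X : Type*} [TopologicalSpace X] {ι : Type*} {Λ : Set (Set X)}

theorem cCompactIn_of_continuous_add_setOpenTopology (hΛ : ∀ A ∈ Λ, A.Nonempty)
    (hadd : Continuous[@instTopologicalSpaceProd _ _ (setOpenTopology ι Λ) (setOpenTopology ι Λ),
      setOpenTopology ι Λ] (fun p : C(X, ι → ℝ) × C(X, ι → ℝ) => p.1 + p.2))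
    {A : Set X} (hA : A ∈ Λ) : CCompactIn ι A := by
  let := setOpenTopology (X := X) ι Λ
  refine cCompactIn_of_forall_isClosed fun f => isClosed_of_closure_subset fun p hp => ?_
  by_contra hpA
  have hcont : Continuous fun c : ι → ℝ => f + ContinuousMap.const X c :=
    hadd.comp (continuous_const.prodMk (continuous_const_setOpenTopology hΛ))
  have hopen := (isOpen_mapsTo_setOpenTopology hA (isOpen_compl_singleton (x := p))).preimage hcont
  have hnhds : {y : ι → ℝ | MapsTo (f + ContinuousMap.const X (p - y)) A {p}ᶜ} ∈ 𝓝 p := by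
    refine (hopen.preimage (show Continuous fun y : ι → ℝ => p - y by fun_prop)).mem_nhds ?_
    intro x hx hxp
    refine hpA ⟨x, hx, ?_⟩
    simpa using hxp
  obtain ⟨_, hy, x, hx, rfl⟩ := mem_closure_iff_nhds.1 hp _ hnhds
  exact hy hx (by simp)

theorem isOpen_mapsTo_of_continuous_add_setOpenTopology
    (hadd : Continuous[@instTopologicalSpaceProd _ _ (setOpenTopology ι Λ) (setOpenTopology ι Λ),
      setOpenTopology ι Λ] (fun p : C(X, ι → ℝ) × C(X, ι → ℝ) => p.1 + p.2))
    {A B : Set X} (hA : A ∈ Λ) (hBA : B ⊆ A) (hB : CCompactIn ι B) {U : Set (ι → ℝ)}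
    (hU : IsOpen U) : IsOpen[setOpenTopology ι Λ] {f : C(X, ι → ℝ) | MapsTo f B U} := by
  let := setOpenTopology (X := X) ι Λ
  refine isOpen_iff_mem_nhds.2 fun f hf => ?_
  obtain ⟨O, hO, hOU⟩ : ∃ O ∈ 𝓝 (0 : ι → ℝ), ∀ c ∈ O, ∀ y ∈ f '' B, c + y ∈ U := by
    have := (hB f).eventually_forall_of_forall_eventually (x₀ := (0 : ι → ℝ))
      (P := fun c y => c + y ∈ U) fun y hy => by
        have : Continuous fun z : (ι → ℝ) × (ι → ℝ) => z.1 + z.2 := by fun_prop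
        refine (hU.preimage this).mem_nhds ?_
        obtain ⟨x, hx, rfl⟩ := hy
        simpa using hf hx
    exact ⟨_, this, fun c hc => hc⟩
  obtain ⟨O', hO'O, hO', h0⟩ := mem_nhds_iff.1 hO
  have hcont : Continuous fun g : C(X, ι → ℝ) => g + -f :=
    hadd.comp (continuous_id.prodMk continuous_const)
  refine Filter.mem_of_superset
    (((isOpen_mapsTo_setOpenTopology hA hO').preimage hcont).mem_nhds ?_) ?_
  · intro x _
    simpa using h0
  · intro g hg x hx
    simpa using hOU _ (hO'O (hg (hBA hx))) _ (mem_image_of_mem f hx)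

theorem continuous_add_setOpenTopology [Nonempty ι] (hC : ∀ A ∈ Λ, CCompactIn ι A)
    (hopen : ∀ A ∈ Λ, ∀ B ⊆ A, CCompactIn ι B → ∀ U : Set (ι → ℝ), IsOpen U →
      IsOpen[setOpenTopology ι Λ] {f : C(X, ι → ℝ) | MapsTo f B U}) :
    Continuous[@instTopologicalSpaceProd _ _ (setOpenTopology ι Λ) (setOpenTopology ι Λ),
      setOpenTopology ι Λ] (fun p : C(X, ι → ℝ) × C(X, ι → ℝ) => p.1 + p.2) := by
  refine continuous_generateFrom_iff.2 ?_
  rintro _ ⟨A, hA, U, hU, rfl⟩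
  let := setOpenTopology (X := X) ι Λ
  refine isOpen_iff_mem_nhds.2 ?_
  rintro ⟨f, g⟩ hfg
  suffices h : {p : C(X, ι → ℝ) × C(X, ι → ℝ) | ∀ x ∈ A,
      (f x, g x) ∈ (fun x => (f x, g x)) '' A → p.1 x + p.2 x ∈ U} ∈ 𝓝 (f, g) from
    Filter.mem_of_superset h fun p hp x hx => hp x hx ⟨x, hx, rfl⟩
  refine ((hC A hA).isCompact_image_prod f g).induction_on
    (p := fun s => {p : C(X, ι → ℝ) × C(X, ι → ℝ) | ∀ x ∈ A,
      (f x, g x) ∈ s → p.1 x + p.2 x ∈ U} ∈ 𝓝 (f, g)) ?_ ?_ ?_ ?_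
  · simp
  · exact fun s t hst ht => Filter.mem_of_superset ht fun p hp x hx hxs => hp x hx (hst hxs)
  · intro s t hs ht
    filter_upwards [hs, ht] with p hps hpt x hx hxst
    exact hxst.elim (hps x hx) (hpt x hx)
  · rintro _ ⟨a, ha, rfl⟩
    have hplus : Continuous fun z : (ι → ℝ) × (ι → ℝ) => z.1 + z.2 := by fun_prop
    obtain ⟨V, W, hV, haV, hW, haW, hVW⟩ := mem_nhds_prod_iff'.1
      ((hU.preimage hplus).mem_nhds (show (f a, g a) ∈ _ from hfg ha))
    obtain ⟨N, hN, hNc, hNVW⟩ := exists_mem_nhds_isClosed_subset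
      ((hV.prod hW).mem_nhds (show (f a, g a) ∈ V ×ˢ W from ⟨haV, haW⟩))
    refine ⟨N, mem_nhdsWithin_of_mem_nhds hN, ?_⟩
    have hB := (hC A hA).inter_preimage_prod f g hNc
    have hBV := hopen A hA _ inter_subset_left hB V hV
    have hBW := hopen A hA _ inter_subset_left hB W hW
    refine Filter.mem_of_superset ((hBV.prod hBW).mem_nhds
      ⟨fun x hx => (hNVW hx.2).1, fun x hx => (hNVW hx.2).2⟩) ?_
    rintro p ⟨hpV, hpW⟩ x hx hxN
    exact hVW (show (p.1 x, p.2 x) ∈ V ×ˢ W from ⟨hpV ⟨hx, hxN⟩, hpW ⟨hx, hxN⟩⟩)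

end Add

theorem statement_1 {X : Type*} [TopologicalSpace X] [T35Space X]
    (ι : Type*) [Nonempty ι] (Λ : Set (Set X)) (hΛ : ∀ A ∈ Λ, A.Nonempty) :
    Continuous[@instTopologicalSpaceProd _ _ (setOpenTopology ι Λ) (setOpenTopology ι Λ),
        setOpenTopology ι Λ]
      (fun p : C(X, ι → ℝ) × C(X, ι → ℝ) => p.1 + p.2) ↔
    (∀ A ∈ Λ, CCompactIn ι A) ∧ Λ = lambdaC ι Λ := by
  refine ⟨fun hadd => ?_, fun ⟨hC, hΛC⟩ => ?_⟩
  · refine ⟨fun A hA => cCompactIn_of_continuous_add_setOpenTopology hΛ hadd hA,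
      Subset.antisymm (fun A hA => ⟨hA, fun B hBA hB U hU => ?_⟩) fun A hA => hA.1⟩
    exact isOpen_mapsTo_of_continuous_add_setOpenTopology hadd hA hBA hB hU
  · refine continuous_add_setOpenTopology hC fun A hA => ?_
    rw [hΛC] at hA
    exact hA.2
end

section
/- The λ-open topology τ_λ makes C(X,ℝ^ι) a topological ring (i.e., addition (f,g) ↦ f+g, negation f ↦ −f, and pointwise multiplication (f,g) ↦ f·g are continuous) if and only if every member of λ is C_ι-compact in X and λ = λ(C_ι). -/
open Topology Set

section CCompact

variable {X : Type*} [TopologicalSpace X] {ι : Type*} {A : Set X}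

theorem CCompactIn.isCompact_image_prodMk [Nonempty ι] (hA : CCompactIn ι A)
    (f g : C(X, ι → ℝ)) : IsCompact ((fun x => (f x, g x)) '' A) := by
  cases finite_or_infinite ι with
  | inl hι =>
    have := Fintype.ofFinite ι
    refine ((hA f).prod (hA g)).of_isClosed_subset ?_ ?_
    · refine isClosed_of_closure_subset fun p hp => ?_
      let d : C(X, ι → ℝ) := ⟨fun x _ => dist (f x, g x) p, by fun_prop⟩
      have hd : (0 : ι → ℝ) ∈ ⇑d '' A := by
        rw [← (hA d).isClosed.closure_eq]
        have hcont : Continuous fun (q : (ι → ℝ) × (ι → ℝ)) (_ : ι) => dist q p := by fun_prop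
        have h := image_closure_subset_closure_image hcont (mem_image_of_mem _ hp)
        rw [image_image] at h
        simp only [dist_self] at h
        exact h
      obtain ⟨x, hx, hx0⟩ := hd
      refine ⟨x, hx, ?_⟩
      have := congrFun hx0 (Classical.arbitrary ι)
      exact dist_eq_zero.1 this
    · rintro _ ⟨x, hx, rfl⟩
      exact ⟨mem_image_of_mem _ hx, mem_image_of_mem _ hx⟩
  | inr hι =>
    obtain ⟨e⟩ : Nonempty (ι ⊕ ι ≃ ι) := by
      rw [← Cardinal.eq, Cardinal.mk_sum, Cardinal.lift_id]
      exact Cardinal.add_eq_self (Cardinal.aleph0_le_mk ι)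
    let F : C(X, ι → ℝ) := ⟨fun x i => Sum.elim (f x) (g x) (e.symm i), by
      refine continuous_pi fun i => ?_
      rcases e.symm i with j | j
      · exact (continuous_apply j).comp f.continuous
      · exact (continuous_apply j).comp g.continuous⟩
    have hcont : Continuous fun p : ι → ℝ =>
        ((fun i => p (e (Sum.inl i))), (fun i => p (e (Sum.inr i)))) := by fun_prop
    have h := (hA F).image hcont
    rw [image_image] at h
    simpa [F] using h

theorem CCompactIn.inter_preimage [Nonempty ι] (hA : CCompactIn ι A) (f : C(X, ι → ℝ))
    {C : Set (ι → ℝ)} (hC : IsClosed C) : CCompactIn ι (A ∩ f ⁻¹' C) := by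
  intro h
  have hK := ((hA.isCompact_image_prodMk f h).inter_right
    (hC.preimage continuous_fst)).image continuous_snd
  convert hK using 1
  ext y
  constructor
  · rintro ⟨x, ⟨hx, hxC⟩, rfl⟩
    exact ⟨(f x, h x), ⟨⟨x, hx, rfl⟩, hxC⟩, rfl⟩
  · rintro ⟨_, ⟨⟨x, hx, rfl⟩, hxC⟩, rfl⟩
    exact ⟨x, ⟨hx, hxC⟩, rfl⟩

end CCompact

section SetOpen

variable {X : Type*} [TopologicalSpace X] {ι : Type*} {Λ : Set (Set X)}

theorem isOpen_setOpenTopology_mapsTo {A : Set X} (hA : A ∈ Λ) {U : Set (ι → ℝ)}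
    (hU : IsOpen U) :
    IsOpen[setOpenTopology ι Λ] {f : C(X, ι → ℝ) | MapsTo f A U} :=
  TopologicalSpace.isOpen_generateFrom_of_mem ⟨A, hA, U, hU, rfl⟩

/-- A pointwise binary operation is continuous for the set-open topology of a family of
`C_ι`-compact sets `Λ` with `Λ = λ(C_ι)`. -/
theorem continuous_setOpenTopology_of_pointwise [Nonempty ι]
    (hcomp : ∀ A ∈ Λ, CCompactIn ι A) (hΛ : Λ = lambdaC ι Λ)
    {φ : (ι → ℝ) × (ι → ℝ) → (ι → ℝ)} (hφ : Continuous φ)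
    {m : C(X, ι → ℝ) × C(X, ι → ℝ) → C(X, ι → ℝ)} (hm : ∀ p x, m p x = φ (p.1 x, p.2 x)) :
    Continuous[@instTopologicalSpaceProd _ _ (setOpenTopology ι Λ) (setOpenTopology ι Λ),
      setOpenTopology ι Λ] m := by
  let _ : TopologicalSpace C(X, ι → ℝ) := setOpenTopology ι Λ
  refine continuous_generateFrom_iff.2 ?_
  rintro _ ⟨A, hA, U, hU, rfl⟩
  refine isOpen_iff_mem_nhds.2 ?_
  rintro ⟨f, g⟩ hfg
  have hbox : ∀ z ∈ (fun x => (f x, g x)) '' A, ∃ C₁ C₂ O₁ O₂ : Set (ι → ℝ),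
      IsClosed C₁ ∧ IsClosed C₂ ∧ IsOpen O₁ ∧ IsOpen O₂ ∧ C₁ ⊆ O₁ ∧ C₂ ⊆ O₂ ∧
      C₁ ×ˢ C₂ ∈ 𝓝 z ∧ O₁ ×ˢ O₂ ⊆ φ ⁻¹' U := by
    rintro _ ⟨x, hx, rfl⟩
    have hxU : (f x, g x) ∈ φ ⁻¹' U := by
      have := hfg hx
      rwa [hm] at this
    obtain ⟨O₁, O₂, hO₁, hxO₁, hO₂, hxO₂, hO⟩ :=
      mem_nhds_prod_iff'.1 ((hU.preimage hφ).mem_nhds hxU)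
    obtain ⟨C₁, hC₁, hC₁c, hCO₁⟩ := exists_mem_nhds_isClosed_subset (hO₁.mem_nhds hxO₁)
    obtain ⟨C₂, hC₂, hC₂c, hCO₂⟩ := exists_mem_nhds_isClosed_subset (hO₂.mem_nhds hxO₂)
    exact ⟨C₁, C₂, O₁, O₂, hC₁c, hC₂c, hO₁, hO₂, hCO₁, hCO₂, prod_mem_nhds hC₁ hC₂, hO⟩
  choose! C₁ C₂ O₁ O₂ hC₁ hC₂ hO₁ hO₂ hCO₁ hCO₂ hC hO using hbox
  obtain ⟨t, htK, htcover⟩ := ((hcomp A hA).isCompact_image_prodMk f g).elim_nhds_subcover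
    (fun z => C₁ z ×ˢ C₂ z) hC
  let B : (ι → ℝ) × (ι → ℝ) → Set X := fun z => (A ∩ f ⁻¹' C₁ z) ∩ g ⁻¹' C₂ z
  have hopen : ∀ z ∈ t, ∀ V : Set (ι → ℝ), IsOpen V →
      IsOpen {h : C(X, ι → ℝ) | MapsTo h (B z) V} := by
    intro z hz
    have hA' : A ∈ lambdaC ι Λ := hΛ ▸ hA
    exact hA'.2 _ (fun x hx => hx.1.1)
      (((hcomp A hA).inter_preimage f (hC₁ z (htK z hz))).inter_preimage g (hC₂ z (htK z hz)))
  have hnhds : (⋂ z ∈ t, {h : C(X, ι → ℝ) | MapsTo h (B z) (O₁ z)} ×ˢ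
      {h : C(X, ι → ℝ) | MapsTo h (B z) (O₂ z)}) ∈ 𝓝 (f, g) := by
    refine (Filter.biInter_finset_mem t).2 fun z hz => prod_mem_nhds ?_ ?_
    · exact (hopen z hz _ (hO₁ z (htK z hz))).mem_nhds fun x hx => hCO₁ z (htK z hz) hx.1.2
    · exact (hopen z hz _ (hO₂ z (htK z hz))).mem_nhds fun x hx => hCO₂ z (htK z hz) hx.2
  refine Filter.mem_of_superset hnhds ?_
  rintro p hp x hx
  obtain ⟨z, hz, hxz⟩ := mem_iUnion₂.1 (htcover (mem_image_of_mem (fun x => (f x, g x)) hx))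
  have hxB : x ∈ B z := ⟨⟨hx, hxz.1⟩, hxz.2⟩
  have hpz := mem_iInter₂.1 hp z hz
  rw [hm]
  exact hO z (htK z hz) ⟨hpz.1 hxB, hpz.2 hxB⟩

theorem continuous_setOpenTopology_neg :
    Continuous[setOpenTopology ι Λ, setOpenTopology ι Λ] (fun f : C(X, ι → ℝ) => -f) := by
  let _ : TopologicalSpace C(X, ι → ℝ) := setOpenTopology ι Λ
  refine continuous_generateFrom_iff.2 ?_
  rintro _ ⟨A, hA, U, hU, rfl⟩
  exact isOpen_setOpenTopology_mapsTo hA (hU.preimage continuous_neg)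

theorem continuous_setOpenTopology_const (hΛ : ∀ A ∈ Λ, A.Nonempty) :
    Continuous[inferInstance, setOpenTopology ι Λ]
      (fun c : ι → ℝ => ContinuousMap.const X c) := by
  refine continuous_generateFrom_iff.2 ?_
  rintro _ ⟨A, hA, U, hU, rfl⟩
  convert hU using 1
  ext c
  obtain ⟨a, ha⟩ := hΛ A hA
  exact ⟨fun h => h ha, fun h _ _ => h⟩

theorem isClosed_image_of_continuous_add_const (hΛ : ∀ A ∈ Λ, A.Nonempty)
    (hadd : ∀ f : C(X, ι → ℝ),
      Continuous[setOpenTopology ι Λ, setOpenTopology ι Λ] fun g => g + f)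
    {A : Set X} (hA : A ∈ Λ) (f : C(X, ι → ℝ)) : IsClosed (f '' A) := by
  refine isClosed_of_closure_subset fun p hp => ?_
  by_contra hpA
  have hO : IsOpen {c : ι → ℝ | MapsTo (ContinuousMap.const X c + f) A {p}ᶜ} :=
    (continuous_def.1 (continuous_setOpenTopology_const hΛ)) _
      ((continuous_def.1 (hadd f)) _ (isOpen_setOpenTopology_mapsTo hA isOpen_compl_singleton))
  have hO' := hO.preimage (f := fun y : ι → ℝ => p - y) (by fun_prop)
  obtain ⟨_, hy, x, hx, rfl⟩ := mem_closure_iff.1 hp _ hO' (by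
    intro x hx hxp
    exact hpA ⟨x, hx, by simpa using hxp⟩)
  exact hy hx (by simp)

theorem cCompactIn_of_continuous_add_const [Nonempty ι] (hΛ : ∀ A ∈ Λ, A.Nonempty)
    (hadd : ∀ f : C(X, ι → ℝ),
      Continuous[setOpenTopology ι Λ, setOpenTopology ι Λ] fun g => g + f)
    {A : Set X} (hA : A ∈ Λ) : CCompactIn ι A := by
  have hclosed (g : C(X, ℝ)) : IsClosed (g '' A) := by
    have h := (isClosed_image_of_continuous_add_const hΛ hadd hA
      ⟨fun x _ => g x, by fun_prop⟩).preimage (f := fun (r : ℝ) (_ : ι) => r) (by fun_prop)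
    convert h using 1
    ext r
    simp [funext_iff]
  have hbounded (g : C(X, ℝ)) : ∃ M : ℝ, ∀ x ∈ A, g x ∈ Icc (-M) M := by
    have hpos (x : X) : 0 < 1 + g x ^ 2 := by positivity
    let h : C(X, ℝ) := ⟨fun x => (1 + g x ^ 2)⁻¹,
      Continuous.inv₀ (by fun_prop) fun x => (hpos x).ne'⟩
    have h0 : (0 : ℝ) ∈ (h '' A)ᶜ := by
      rintro ⟨x, -, hx⟩
      exact (inv_pos.2 (hpos x)).ne' hx
    obtain ⟨ε, hε, hball⟩ := Metric.isOpen_iff.1 (hclosed h).isOpen_compl 0 h0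
    refine ⟨1 + ε⁻¹, fun x hx => ?_⟩
    have hle : ε ≤ (1 + g x ^ 2)⁻¹ := by
      by_contra! hlt
      refine hball (a := h x) ?_ ⟨x, hx, rfl⟩
      rw [mem_ball_zero_iff, Real.norm_eq_abs, abs_of_pos (show 0 < h x from inv_pos.2 (hpos x))]
      exact hlt
    have hsq : 1 + g x ^ 2 ≤ ε⁻¹ := (le_inv_comm₀ hε (hpos x)).1 hle
    have := inv_pos.2 hε
    constructor <;> nlinarith
  intro f
  choose M hM using fun i : ι => hbounded ⟨fun x => f x i, by fun_prop⟩
  refine (isCompact_univ_pi fun i => isCompact_Icc (a := -M i) (b := M i)).of_isClosed_subset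
    (isClosed_image_of_continuous_add_const hΛ hadd hA f) ?_
  rintro _ ⟨x, hx, rfl⟩ i -
  exact hM i x hx

theorem isOpen_mapsTo_of_continuous_add_const
    (hadd : ∀ f : C(X, ι → ℝ),
      Continuous[setOpenTopology ι Λ, setOpenTopology ι Λ] fun g => g + f)
    {A B : Set X} (hA : A ∈ Λ) (hBA : B ⊆ A) (hB : CCompactIn ι B) {U : Set (ι → ℝ)}
    (hU : IsOpen U) :
    IsOpen[setOpenTopology ι Λ] {f : C(X, ι → ℝ) | MapsTo f B U} := by
  let _ : TopologicalSpace C(X, ι → ℝ) := setOpenTopology ι Λ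
  refine isOpen_iff_mem_nhds.2 fun f hf => ?_
  obtain ⟨V, hV, hVU⟩ := compact_open_separated_add_right (hB f) hU hf.image_subset
  obtain ⟨W, hWV, hW, hW0⟩ := mem_nhds_iff.1 hV
  have hN := ((isOpen_setOpenTopology_mapsTo hA hW).preimage (hadd (-f))).mem_nhds
    (show f ∈ (fun g : C(X, ι → ℝ) => g + -f) ⁻¹' {g | MapsTo g A W} by
      intro x _
      simpa using hW0)
  refine Filter.mem_of_superset hN fun g hg x hx => hVU ?_
  refine Set.mem_add.2 ⟨f x, mem_image_of_mem _ hx, (g + -f) x, hWV (hg (hBA hx)), ?_⟩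
  simp

end SetOpen

theorem statement_6 {X : Type*} [TopologicalSpace X] [T35Space X]
    (ι : Type*) [Nonempty ι] (Λ : Set (Set X)) (hΛ : ∀ A ∈ Λ, A.Nonempty) :
    (Continuous[@instTopologicalSpaceProd _ _ (setOpenTopology ι Λ) (setOpenTopology ι Λ),
        setOpenTopology ι Λ]
        (fun p : C(X, ι → ℝ) × C(X, ι → ℝ) => p.1 + p.2) ∧
      Continuous[setOpenTopology ι Λ, setOpenTopology ι Λ]
        (fun f : C(X, ι → ℝ) => -f) ∧
      Continuous[@instTopologicalSpaceProd _ _ (setOpenTopology ι Λ) (setOpenTopology ι Λ),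
        setOpenTopology ι Λ]
        (fun p : C(X, ι → ℝ) × C(X, ι → ℝ) => p.1 * p.2)) ↔
    (∀ A ∈ Λ, CCompactIn ι A) ∧ Λ = lambdaC ι Λ := by
  constructor
  · rintro ⟨hadd, -, -⟩
    have hadd' : ∀ f : C(X, ι → ℝ),
        Continuous[setOpenTopology ι Λ, setOpenTopology ι Λ] fun g => g + f := by
      let _ : TopologicalSpace C(X, ι → ℝ) := setOpenTopology ι Λ
      exact fun f => hadd.comp (continuous_id.prodMk continuous_const)
    refine ⟨fun A hA => cCompactIn_of_continuous_add_const hΛ hadd' hA,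
      Subset.antisymm (fun A hA => ⟨hA, fun B hBA hB U hU => ?_⟩) fun A hA => hA.1⟩
    exact isOpen_mapsTo_of_continuous_add_const hadd' hA hBA hB hU
  · rintro ⟨hcomp, hΛC⟩
    exact ⟨continuous_setOpenTopology_of_pointwise hcomp hΛC
        (φ := fun q => q.1 + q.2) (by fun_prop) fun _ _ => rfl,
      continuous_setOpenTopology_neg,
      continuous_setOpenTopology_of_pointwise hcomp hΛC
        (φ := fun q => q.1 * q.2) (by fun_prop) fun _ _ => rfl⟩
end

section
/- The λ-open topology τ_λ on C(X,ℝ^ι) is Hausdorff if and only if λ is a π-network of X, i.e., every nonempty open subset of X contains some member of λ. -/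
open Topology Set

/-- The subbasic sets `[A, U]` are open in the set-open topology. -/
theorem isOpen_setOf_mapsTo_setOpenTopology {X : Type*} [TopologicalSpace X] (ι : Type*)
    {Λ : Set (Set X)} {A : Set X} (hA : A ∈ Λ) {U : Set (ι → ℝ)} (hU : IsOpen U) :
    IsOpen[setOpenTopology ι Λ] {f : C(X, ι → ℝ) | Set.MapsTo f A U} :=
  TopologicalSpace.isOpen_generateFrom_of_mem ⟨A, hA, U, hU, rfl⟩

/-- If `g` takes the value `c` somewhere on each member of `Λ`, then every set-open neighbourhood of `g`
contains the constant map `c`. -/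
theorem const_mem_of_isOpen_setOpenTopology {X : Type*} [TopologicalSpace X] {ι : Type*}
    {Λ : Set (Set X)} {g : C(X, ι → ℝ)} {c : ι → ℝ} (hg : ∀ A ∈ Λ, ∃ a ∈ A, g a = c)
    {S : Set C(X, ι → ℝ)} (hS : IsOpen[setOpenTopology ι Λ] S) (hgS : g ∈ S) :
    ContinuousMap.const X c ∈ S := by
  induction hS with
  | basic S hS =>
    obtain ⟨A, hA, U, -, rfl⟩ := hS
    obtain ⟨a, ha, rfl⟩ := hg A hA
    exact fun _ _ => hgS ha
  | univ => trivial
  | inter S T _ _ ihS ihT => exact ⟨ihS hgS.1, ihT hgS.2⟩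
  | sUnion 𝒮 _ ih =>
    obtain ⟨S, hS, hgS⟩ := hgS
    exact ⟨S, hS, ih S hS hgS⟩

theorem statement_11 {X : Type*} [TopologicalSpace X] [T35Space X]
    (ι : Type*) [Nonempty ι] (Λ : Set (Set X)) (hΛ : ∀ A ∈ Λ, A.Nonempty) :
    @T2Space C(X, ι → ℝ) (setOpenTopology ι Λ) ↔
      ∀ U : Set X, IsOpen U → U.Nonempty → ∃ A ∈ Λ, A ⊆ U := by
  constructor
  · rintro hT2 O hO ⟨x, hx⟩
    by_contra! hne
    obtain ⟨h, hcont, hx0, h1⟩ := CompletelyRegularSpace.completely_regular x Oᶜ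
      hO.isClosed_compl (fun hxO => hxO hx)
    let g : C(X, ι → ℝ) := ⟨fun y _ => (h y : ℝ), by fun_prop⟩
    have hg : ∀ A ∈ Λ, ∃ a ∈ A, g a = 1 := fun A hA => by
      obtain ⟨a, ha, haO⟩ := Set.not_subset.1 (hne A hA)
      refine ⟨a, ha, funext fun _ => ?_⟩
      simp [g, h1 haO]
    have hneq : g ≠ ContinuousMap.const X 1 := fun heq => by
      have := congrFun (DFunLike.congr_fun heq x) (Classical.arbitrary ι)
      simp [g, hx0] at this
    obtain ⟨S, T, hS, hT, hgS, hcT, hST⟩ := hT2.t2 hneq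
    exact Set.disjoint_left.1 hST (const_mem_of_isOpen_setOpenTopology hg hS hgS) hcT
  · intro hnet
    refine @T2Space.mk _ (setOpenTopology ι Λ) fun f g hfg => ?_
    obtain ⟨x, hx⟩ := DFunLike.ne_iff.1 hfg
    obtain ⟨U, V, hU, hV, hxU, hxV, hUV⟩ := t2_separation hx
    obtain ⟨A, hA, hAW⟩ := hnet (f ⁻¹' U ∩ g ⁻¹' V)
      ((hU.preimage f.continuous).inter (hV.preimage g.continuous)) ⟨x, hxU, hxV⟩
    obtain ⟨a, ha⟩ := hΛ A hA
    exact ⟨_, _, isOpen_setOf_mapsTo_setOpenTopology ι hA hU,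
      isOpen_setOf_mapsTo_setOpenTopology ι hA hV, fun y hy => (hAW hy).1,
      fun y hy => (hAW hy).2,
      Set.disjoint_left.2 fun k hkU hkV => Set.disjoint_left.1 hUV (hkU ha) (hkV ha)⟩
end
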